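/- If I ⊂ (0, ∞) is open, then the sets Ω_∞⁺(I) = {w ∈ p⁻¹(I) : |x̄(t,w)| → ∞ as t → +∞} and Ω_∞⁻(I) = {w ∈ p⁻¹(I) : |x̄(t,w)| → ∞ as t → −∞} are open subsets of ℝⁿ × ℝⁿ. -/

import Mathlib

open Filter
open scoped RealInnerProductSpace Topology

theorem escape_aux (f g h : ℝ → ℝ) (A T : ℝ) (hf : ∀ t, HasDerivAt f (g t) t)
    (hg : ∀ t, HasDerivAt g (h t) t) (hh : ∀ t, A ≤ f t → 0 ≤ h t)
    (hfT : A < f T) (hgT : 0 < g T) : Tendsto f atTop atTop := by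
  have hfc : Continuous f := continuous_iff_continuousAt.2 fun t => (hf t).continuousAt
  have hgc : Continuous g := continuous_iff_continuousAt.2 fun t => (hg t).continuousAt
  have key : ∀ s, T ≤ s → (∀ t ∈ Set.Ico T s, A < f t) → f T + g T * (s - T) ≤ f s := by
    intro s hs hlt
    have hgm : MonotoneOn g (Set.Icc T s) := by
      apply monotoneOn_of_deriv_nonneg (convex_Icc T s) hgc.continuousOn
      · exact fun t _ => (hg t).differentiableAt.differentiableWithinAt
      · intro t ht
        rw [interior_Icc] at ht
        rw [(hg t).deriv]
        exact hh t (hlt t ⟨ht.1.le, ht.2⟩).le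
    have := (convex_Icc T s).mul_sub_le_image_sub_of_le_deriv (C := g T) hfc.continuousOn
      (fun t _ => (hf t).differentiableAt.differentiableWithinAt)
      (by
        intro t ht
        rw [interior_Icc] at ht
        rw [(hf t).deriv]
        exact hgm ⟨le_rfl, hs⟩ ⟨ht.1.le, ht.2.le⟩ ht.1.le)
      T ⟨le_rfl, hs⟩ s ⟨hs, le_rfl⟩ hs
    linarith
  have hall : ∀ t, T ≤ t → A < f t := by
    by_contra! hcon
    obtain ⟨t, hTt, hft⟩ := hcon
    have hK : IsCompact (Set.Icc T t ∩ {u | f u ≤ A}) :=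
      isCompact_Icc.inter_right (isClosed_le hfc continuous_const)
    obtain ⟨s, hs, hmin⟩ := hK.exists_isLeast ⟨t, ⟨hTt, le_rfl⟩, hft⟩
    have h1 := key s hs.1.1 (by
      intro u hu
      by_contra! hc
      exact absurd (hmin ⟨⟨hu.1, hu.2.le.trans hs.1.2⟩, hc⟩) (not_le.2 hu.2))
    have h2 : f s ≤ A := hs.2
    have h3 : 0 ≤ g T * (s - T) := mul_nonneg hgT.le (sub_nonneg.2 hs.1.1)
    linarith
  have hlin : Tendsto (fun t => f T + g T * (t - T)) atTop atTop := by
    apply tendsto_atTop_add_const_left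
    apply Tendsto.const_mul_atTop hgT
    exact tendsto_atTop_add_const_right _ _ tendsto_id
  refine tendsto_atTop_mono' _ ?_ hlin
  filter_upwards [eventually_ge_atTop T] with t ht
  exact key t ht fun u hu => hall u hu.1

theorem escape_conv (f g : ℝ → ℝ) (A : ℝ) (hf : ∀ t, HasDerivAt f (g t) t)
    (hft : Tendsto f atTop atTop) : ∃ T, 0 ≤ T ∧ A < f T ∧ 0 < g T := by
  obtain ⟨T0, hT0⟩ := eventually_atTop.1 ((hft.eventually_gt_atTop A).and (eventually_ge_atTop 0))
  obtain ⟨t1, ht1, ht1'⟩ := ((hft.eventually_gt_atTop (f T0)).and (eventually_gt_atTop T0)).exists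
  obtain ⟨c, hc, hce⟩ := exists_hasDerivAt_eq_slope f g ht1'
    (fun t _ => (hf t).continuousAt.continuousWithinAt) (fun t _ => hf t)
  refine ⟨c, (hT0 c hc.1.le).2, (hT0 c hc.1.le).1, ?_⟩
  rw [hce]
  exact div_pos (by linarith) (by linarith)

theorem open_aux {E : Type*} [NormedAddCommGroup E] [InnerProductSpace ℝ E] [CompleteSpace E]
    (ρ : ℝ) (hρ : 0 < ρ) (V : E → ℝ) (hV : ContDiff ℝ (⊤ : ℕ∞) V)
    (hdecay : ∀ k : ℕ, ∃ C : ℝ, 0 ≤ C ∧ ∀ x,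
      ‖iteratedFDeriv ℝ k V x‖ ≤ C * (1 + ‖x‖ ^ 2) ^ ((-ρ - (k : ℝ)) / 2))
    (p : E × E → ℝ) (hp : ∀ w, p w = ‖w.2‖ ^ 2 + V w.1)
    (φ : ℝ → E × E → E × E) (hφ₀ : ∀ w, φ 0 w = w)
    (hflow : ∀ w t, HasDerivAt (fun s => φ s w)
      ((2 : ℝ) • (φ t w).2, -gradient V (φ t w).1) t)
    (I : Set ℝ) (hI : I ⊆ Set.Ioi 0) (hIo : IsOpen I) :
    IsOpen {w : E × E | p w ∈ I ∧ Tendsto (fun t : ℝ => ‖(φ t w).1‖) atTop atTop} := by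
  have hVd : Differentiable ℝ V := hV.differentiable (by simp)
  have hgrad : ∀ x, HasGradientAt V (gradient V x) x := fun x => (hVd x).hasGradientAt
  have hgn : ∀ x, ‖gradient V x‖ = ‖fderiv ℝ V x‖ := by
    intro x; simp [gradient]
  have hp_cont : Continuous p := by
    have : p = fun w => ‖w.2‖ ^ 2 + V w.1 := funext hp
    rw [this]
    have := hV.continuous
    fun_prop
  have hx : ∀ w t, HasDerivAt (fun s => (φ s w).1) ((2 : ℝ) • (φ t w).2) t :=
    fun w t => (ContinuousLinearMap.fst ℝ E E).hasFDerivAt.comp_hasDerivAt t (hflow w t)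
  have hξ : ∀ w t, HasDerivAt (fun s => (φ s w).2) (-gradient V (φ t w).1) t :=
    fun w t => (ContinuousLinearMap.snd ℝ E E).hasFDerivAt.comp_hasDerivAt t (hflow w t)
  -- energy conservation
  have henergy : ∀ w t, p (φ t w) = p w := by
    intro w t
    have hd : ∀ t, HasDerivAt (fun s => p (φ s w)) 0 t := by
      intro t
      have h1 := (hξ w t).norm_sq
      have h2 := (hgrad (φ t w).1).hasFDerivAt.comp_hasDerivAt t (hx w t)
      have h3 := h1.add h2
      have : (fun s => p (φ s w)) = fun s => ‖(φ s w).2‖ ^ 2 + V (φ s w).1 := by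
        funext s; exact hp _
      rw [this]
      refine h3.congr_deriv ?_
      simp [inner_smul_right, inner_neg_right, real_inner_comm]
    have := is_const_of_deriv_eq_zero (fun t => (hd t).differentiableAt) (fun t => (hd t).deriv) t 0
    simpa [hφ₀] using this
  -- Lipschitz vector field
  obtain ⟨C2, hC2, hb2⟩ := hdecay 2
  have hLip : ∀ x y, ‖gradient V x - gradient V y‖ ≤ C2 * ‖x - y‖ := by
    intro x y
    have h1 : ‖gradient V x - gradient V y‖ = ‖fderiv ℝ V x - fderiv ℝ V y‖ := by
      simp only [gradient, ← map_sub, LinearIsometryEquiv.norm_map]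
    rw [h1]
    refine convex_univ.norm_image_sub_le_of_norm_fderiv_le (𝕜 := ℝ) (f := fderiv ℝ V)
      (C := C2) ?_ ?_ (Set.mem_univ _) (Set.mem_univ _)
    · intro z _
      exact (hV.fderiv_right (m := 1) (by norm_cast)).differentiable (by simp) z
    · intro z _
      rw [← norm_iteratedFDeriv_one, norm_iteratedFDeriv_fderiv]
      refine (hb2 z).trans (mul_le_of_le_one_right hC2 ?_)
      apply Real.rpow_le_one_of_one_le_of_nonpos
      · nlinarith [sq_nonneg ‖z‖]
      · push_cast; linarith
  let F : E × E → E × E := fun w => ((2 : ℝ) • w.2, -gradient V w.1)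
  have hF : LipschitzWith (Real.toNNReal (2 + C2)) F := by
    apply LipschitzWith.of_dist_le_mul
    intro a b
    rw [Real.coe_toNNReal _ (by linarith), dist_eq_norm, dist_eq_norm, Prod.norm_def]
    have ha := norm_fst_le (a - b)
    have hb := norm_snd_le (a - b)
    have h0 := norm_nonneg (a - b)
    apply max_le
    · have : (F a - F b).1 = (2 : ℝ) • (a - b).2 := by simp [F, smul_sub]
      rw [this, norm_smul]
      rw [Real.norm_of_nonneg zero_le_two]
      nlinarith
    · have : (F a - F b).2 = -(gradient V a.1 - gradient V b.1) := by simp [F]; abel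
      rw [this, norm_neg]
      refine (hLip _ _).trans ?_
      have : ‖a.1 - b.1‖ ≤ ‖a - b‖ := ha
      nlinarith
  have hcont : ∀ T, 0 ≤ T → Continuous (φ T) := by
    intro T hT
    have : LipschitzWith (Real.toNNReal (Real.exp (Real.toNNReal (2 + C2) * T))) (φ T) := by
      apply LipschitzWith.of_dist_le_mul
      intro a b
      rw [Real.coe_toNNReal _ (Real.exp_pos _).le]
      have h := dist_le_of_trajectories_ODE (v := fun _ => F) (f := fun t => φ t a)
        (g := fun t => φ t b) (a := 0) (b := T) (δ := dist a b) (fun _ => hF)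
        (fun t _ => (hflow a t).continuousAt.continuousWithinAt)
        (fun t _ => (hflow a t).hasDerivWithinAt)
        (fun t _ => (hflow b t).continuousAt.continuousWithinAt)
        (fun t _ => (hflow b t).hasDerivWithinAt)
        (by simp [hφ₀]) T ⟨hT, le_rfl⟩
      simpa [mul_comm] using h
    exact this.continuous
  -- derivatives of the squared radius
  have hf : ∀ w t, HasDerivAt (fun s => ‖(φ s w).1‖ ^ 2) (4 * ⟪(φ t w).1, (φ t w).2⟫) t := by
    intro w t
    refine (hx w t).norm_sq.congr_deriv ?_
    rw [inner_smul_right]; ring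
  have hg : ∀ w t, HasDerivAt (fun s => 4 * ⟪(φ s w).1, (φ s w).2⟫)
      (8 * ‖(φ t w).2‖ ^ 2 - 4 * ⟪(φ t w).1, gradient V (φ t w).1⟫) t := by
    intro w t
    refine (((hx w t).inner ℝ (hξ w t)).const_mul 4).congr_deriv ?_
    rw [inner_smul_left, inner_neg_right, real_inner_self_eq_norm_sq]
    simp; ring
  obtain ⟨C0, hC0, hb0⟩ := hdecay 0
  obtain ⟨C1, hC1, hb1⟩ := hdecay 1
  have hconv : ∀ e, 0 < e → ∃ A, ∀ w : E × E, A ≤ ‖w.1‖ ^ 2 → e ≤ p w →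
      0 ≤ 8 * ‖w.2‖ ^ 2 - 4 * ⟪w.1, gradient V w.1⟫ := by
    intro e he
    have hlim : Tendsto (fun r : ℝ => (8 * C0 + 4 * C1) * (1 + r) ^ (-(ρ / 2))) atTop (𝓝 0) := by
      have := ((tendsto_rpow_neg_atTop (half_pos hρ)).comp
        (tendsto_atTop_add_const_left atTop (1 : ℝ) tendsto_id)).const_mul (8 * C0 + 4 * C1)
      simpa using this
    obtain ⟨A, hA⟩ := eventually_atTop.1 (hlim.eventually_lt_const (show 0 < 8 * e by linarith))
    refine ⟨A, fun w hw hwe => ?_⟩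
    have h1 := hA _ hw
    have h2 := hb0 w.1
    have h3 := hb1 w.1
    rw [norm_iteratedFDeriv_zero] at h2
    rw [norm_iteratedFDeriv_one, ← hgn] at h3
    have hbase : (0 : ℝ) < 1 + ‖w.1‖ ^ 2 := by positivity
    have e0 : (-ρ - ((0 : ℕ) : ℝ)) / 2 = -(ρ / 2) := by push_cast; ring
    have e1 : (-ρ - ((1 : ℕ) : ℝ)) / 2 = -(ρ / 2) + -(1 / 2) := by push_cast; ring
    rw [e0] at h2
    rw [e1, Real.rpow_add hbase] at h3
    have h4 : ‖w.1‖ * (1 + ‖w.1‖ ^ 2) ^ (-(1 / 2) : ℝ) ≤ 1 := by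
      rw [Real.rpow_neg hbase.le, ← Real.sqrt_eq_rpow, ← div_eq_mul_inv,
        div_le_one (Real.sqrt_pos.2 hbase)]
      apply Real.le_sqrt_of_sq_le
      linarith
    have h5 : ⟪w.1, gradient V w.1⟫ ≤ C1 * (1 + ‖w.1‖ ^ 2) ^ (-(ρ / 2)) := by
      calc ⟪w.1, gradient V w.1⟫ ≤ ‖w.1‖ * ‖gradient V w.1‖ := real_inner_le_norm _ _
        _ ≤ ‖w.1‖ * (C1 * ((1 + ‖w.1‖ ^ 2) ^ (-(ρ / 2)) * (1 + ‖w.1‖ ^ 2) ^ (-(1 / 2) : ℝ))) := by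
            gcongr
        _ = C1 * (1 + ‖w.1‖ ^ 2) ^ (-(ρ / 2)) *
            (‖w.1‖ * (1 + ‖w.1‖ ^ 2) ^ (-(1 / 2) : ℝ)) := by ring
        _ ≤ _ := mul_le_of_le_one_right (by positivity) h4
    have h6 := hp w
    have h7 := (le_abs_self _).trans h2
    nlinarith
  rw [isOpen_iff_mem_nhds]
  rintro w ⟨hwI, hw⟩
  have hpw : 0 < p w := hI hwI
  obtain ⟨A, hA⟩ := hconv (p w / 2) (half_pos hpw)
  obtain ⟨T, hT0, hT1, hT2⟩ := escape_conv _ _ A (hf w)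
    ((tendsto_pow_atTop two_ne_zero).comp hw)
  have hc := hcont T hT0
  have n1 : ∀ᶠ v in 𝓝 w, p v ∈ I := hp_cont.continuousAt.eventually_mem (hIo.mem_nhds hwI)
  have n2 : ∀ᶠ v in 𝓝 w, p w / 2 < p v :=
    (hp_cont.tendsto w).eventually_const_lt (half_lt_self hpw)
  have n3 : ∀ᶠ v in 𝓝 w, A < ‖(φ T v).1‖ ^ 2 :=
    Tendsto.eventually_const_lt hT1
      (show ContinuousAt (fun v => ‖(φ T v).1‖ ^ 2) w by fun_prop)
  have n4 : ∀ᶠ v in 𝓝 w, 0 < 4 * ⟪(φ T v).1, (φ T v).2⟫ :=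
    Tendsto.eventually_const_lt hT2
      (show ContinuousAt (fun v => 4 * ⟪(φ T v).1, (φ T v).2⟫) w by fun_prop)
  filter_upwards [n1, n2, n3, n4] with v h1 h2 h3 h4
  refine ⟨h1, ?_⟩
  have h5 := escape_aux _ _ _ A T (hf v) (hg v)
    (fun t ht => hA _ ht (by rw [henergy]; exact h2.le)) h3 h4
  have h6 := Real.tendsto_sqrt_atTop.comp h5
  refine h6.congr fun t => ?_
  simp [Real.sqrt_sq (norm_nonneg _)]

/-- If `I ⊂ (0,∞)` is open, the sets `Ω_∞⁺(I)` and `Ω_∞⁻(I)` of points of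
energy in `I` whose trajectories escape to infinity in the future (resp. past) are open. -/
theorem stmt_9
    (n : ℕ) (hn : 1 ≤ n) (ρ : ℝ) (hρ : 0 < ρ)
    (V₁ : EuclideanSpace ℝ (Fin n) → ℝ)
    (hV₁ : ContDiff ℝ (⊤ : ℕ∞) V₁)
    (hV₁decay : ∀ k : ℕ, ∃ C : ℝ, 0 ≤ C ∧ ∀ x,
      ‖iteratedFDeriv ℝ k V₁ x‖ ≤ C * (1 + ‖x‖ ^ 2) ^ ((-ρ - (k : ℝ)) / 2))
    (p : EuclideanSpace ℝ (Fin n) × EuclideanSpace ℝ (Fin n) → ℝ)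
    (hp : ∀ w, p w = ‖w.2‖ ^ 2 + V₁ w.1)
    (φ : ℝ → EuclideanSpace ℝ (Fin n) × EuclideanSpace ℝ (Fin n) →
      EuclideanSpace ℝ (Fin n) × EuclideanSpace ℝ (Fin n))
    (hφ₀ : ∀ w, φ 0 w = w)
    (hflow : ∀ w t, HasDerivAt (fun s => φ s w)
      ((2 : ℝ) • (φ t w).2, -gradient V₁ (φ t w).1) t) :
    ∀ I : Set ℝ, I ⊆ Set.Ioi 0 → IsOpen I →
      IsOpen {w : EuclideanSpace ℝ (Fin n) × EuclideanSpace ℝ (Fin n) |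
        p w ∈ I ∧ Tendsto (fun t : ℝ => ‖(φ t w).1‖) atTop atTop} ∧
      IsOpen {w : EuclideanSpace ℝ (Fin n) × EuclideanSpace ℝ (Fin n) |
        p w ∈ I ∧ Tendsto (fun t : ℝ => ‖(φ t w).1‖) atBot atTop} := by
  intro I hI hIo
  refine ⟨open_aux ρ hρ V₁ hV₁ hV₁decay p hp φ hφ₀ hflow I hI hIo, ?_⟩
  let L : (EuclideanSpace ℝ (Fin n) × EuclideanSpace ℝ (Fin n)) →L[ℝ]
      (EuclideanSpace ℝ (Fin n) × EuclideanSpace ℝ (Fin n)) :=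
    (ContinuousLinearMap.fst ℝ _ _).prod (-ContinuousLinearMap.snd ℝ _ _)
  have hL : ∀ w, L w = (w.1, -w.2) := fun w => rfl
  have key := open_aux ρ hρ V₁ hV₁ hV₁decay p hp (fun t w => L (φ (-t) (L w)))
    (fun w => by simp [hφ₀, hL])
    (fun w t => by
      have h1 := (hflow (L w) (-t)).scomp t (hasDerivAt_neg t)
      have h2 := L.hasFDerivAt.comp_hasDerivAt t h1
      refine h2.congr_deriv ?_
      simp [hL])
    I hI hIo
  have h3 := key.preimage L.continuous
  convert h3 using 1
  ext w
  have hLL : L (L w) = w := by simp [hL]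
  have hpL : p (L w) = p w := by simp [hp, hL]
  simp only [Set.mem_setOf_eq, Set.mem_preimage, hLL, hpL]
  refine and_congr_right fun _ => ?_
  have h4 : (fun t : ℝ => ‖(L (φ (-t) w)).1‖) = (fun t => ‖(φ t w).1‖) ∘ Neg.neg := rfl
  rw [h4]
  constructor
  · exact fun h => h.comp tendsto_neg_atTop_atBot
  · intro h
    have := h.comp tendsto_neg_atBot_atTop
    simpa [Function.comp_def] using this
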